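/- arXiv:2601.16784 — 5 statements merged into one kernel-verified Lean document; each statement's English description precedes it below -/
import Mathlib

section
/- Let X̃ ∈ ℝ^{n×d} and Y ∈ ℝ^{p×d} both have rank d. Suppose Ū ∈ ℝ^{n×d} and V̄ ∈ ℝ^{p×d} have orthonormal columns, Σ̄ ∈ ℝ^{d×d} is diagonal with strictly positive diagonal entries, and X̃ Yᵀ = Ū Σ̄ V̄ᵀ. Define X̄ = Ū Σ̄^{1/2} and Ȳ = V̄ Σ̄^{1/2}. Then there exist invertible matrices K, R ∈ ℝ^{d×d} such that X̄ = X̃ K, Ȳ = Y R, and moreover K Rᵀ = I_d. -/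
open Matrix

/-- **Existence of the alignment matrices `K` and `R`.**
If `X̃ ∈ ℝ^{n×d}` and `Y ∈ ℝ^{p×d}` have rank `d`, and `X̃ Yᵀ = Ū Σ̄ V̄ᵀ` with `Ū, V̄`
having orthonormal columns and `Σ̄` diagonal with positive entries, then setting
`X̄ = Ū Σ̄^{1/2}` and `Ȳ = V̄ Σ̄^{1/2}`, there are invertible `K, R` with
`X̄ = X̃ K`, `Ȳ = Y R` and `K Rᵀ = I`. -/
theorem exists_alignment_matrices {n p d : ℕ}
    (Xt : Matrix (Fin n) (Fin d) ℝ) (Y : Matrix (Fin p) (Fin d) ℝ)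
    (hX : Xt.rank = d) (hY : Y.rank = d)
    (U : Matrix (Fin n) (Fin d) ℝ) (V : Matrix (Fin p) (Fin d) ℝ)
    (σ : Fin d → ℝ) (hσ : ∀ i, 0 < σ i)
    (hU : Uᵀ * U = 1) (hV : Vᵀ * V = 1)
    (hSVD : Xt * Yᵀ = U * Matrix.diagonal σ * Vᵀ) :
    ∃ K R : Matrix (Fin d) (Fin d) ℝ, IsUnit K ∧ IsUnit R ∧
      U * Matrix.diagonal (fun i => Real.sqrt (σ i)) = Xt * K ∧
      V * Matrix.diagonal (fun i => Real.sqrt (σ i)) = Y * R ∧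
      K * Rᵀ = 1 := by
  set S := Matrix.diagonal fun i => Real.sqrt (σ i) with hS
  set T := Matrix.diagonal fun i => (Real.sqrt (σ i))⁻¹ with hT
  have hSS : Matrix.diagonal σ = S * S := by
    simp [hS, Matrix.diagonal_mul_diagonal, Real.mul_self_sqrt (hσ _).le]
  have hST : S * T = 1 := by
    simp [hS, hT, Matrix.diagonal_mul_diagonal, (Real.sqrt_pos.2 (hσ _)).ne']
  have hTS : T * S = 1 := mul_eq_one_comm.1 hST
  have hSt : Sᵀ = S := Matrix.diagonal_transpose _
  have hTt : Tᵀ = T := Matrix.diagonal_transpose _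
  rw [hSS] at hSVD
  have hSVDt : Y * Xtᵀ = V * (S * S) * Uᵀ := by
    simpa [Matrix.transpose_mul, hSt, Matrix.mul_assoc] using congrArg Matrix.transpose hSVD
  have hXK : Xt * (Yᵀ * V * T) = U * S := calc
    Xt * (Yᵀ * V * T) = Xt * Yᵀ * V * T := by simp only [Matrix.mul_assoc]
    _ = U * S * (S * ((Vᵀ * V) * T)) := by rw [hSVD]; simp only [Matrix.mul_assoc]
    _ = U * S := by rw [hV, Matrix.one_mul, hST, Matrix.mul_one]
  have hYR : Y * (Xtᵀ * U * T) = V * S := calc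
    Y * (Xtᵀ * U * T) = Y * Xtᵀ * U * T := by simp only [Matrix.mul_assoc]
    _ = V * S * (S * ((Uᵀ * U) * T)) := by rw [hSVDt]; simp only [Matrix.mul_assoc]
    _ = V * S := by rw [hU, Matrix.one_mul, hST, Matrix.mul_one]
  have hRK : (Xtᵀ * U * T)ᵀ * (Yᵀ * V * T) = 1 := calc
    (Xtᵀ * U * T)ᵀ * (Yᵀ * V * T) = T * (Uᵀ * (Xt * (Yᵀ * V * T))) := by
      simp only [Matrix.transpose_mul, Matrix.transpose_transpose, hTt, Matrix.mul_assoc]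
    _ = T * ((Uᵀ * U) * S) := by rw [hXK, Matrix.mul_assoc]
    _ = 1 := by rw [hU, Matrix.one_mul, hTS]
  have hKR := mul_eq_one_comm.1 hRK
  exact ⟨Yᵀ * V * T, Xtᵀ * U * T, IsUnit.of_mul_eq_one _ hKR,
    (Matrix.isUnit_transpose _).1 (IsUnit.of_mul_eq_one _ hRK), hXK.symm, hYR.symm, hKR⟩
end

section
/- Let X̃ ∈ ℝ^{n×d} and Y ∈ ℝ^{p×d} both have rank d, let Ū ∈ ℝ^{n×d} and V̄ ∈ ℝ^{p×d} have orthonormal columns, let Σ̄ ∈ ℝ^{d×d} be diagonal with strictly positive diagonal entries, and suppose X̃ Yᵀ = Ū Σ̄ V̄ᵀ. Suppose K, R ∈ ℝ^{d×d} are invertible matrices with X̃ K = Ū Σ̄^{1/2}, Y R = V̄ Σ̄^{1/2}, and K Rᵀ = I_d. Then K Σ̄ Kᵀ = Yᵀ Y, R Σ̄ Rᵀ = X̃ᵀ X̃, (R Σ̄^{−1} K^{−1})ᵀ = (Yᵀ Y)^{−1}, and (K Σ̄^{−1} R^{−1})ᵀ = (X̃ᵀ X̃)^{−1}. -/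
open Matrix

theorem mul_diagonal_mul_transpose_eq_gram {m n : Type*} [Fintype m] [Fintype n] [DecidableEq n]
    {A W : Matrix m n ℝ} {σ : n → ℝ} (hσ : ∀ i, 0 ≤ σ i) (hW : Wᵀ * W = 1)
    {K R : Matrix n n ℝ} (hAR : A * R = W * Matrix.diagonal (fun i => Real.sqrt (σ i)))
    (hKR : K * Rᵀ = 1) : K * Matrix.diagonal σ * Kᵀ = Aᵀ * A := by
  have hRK : R * Kᵀ = 1 := by simpa using congrArg Matrix.transpose hKR
  have hgram : (A * R)ᵀ * (A * R) = Matrix.diagonal σ := by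
    rw [hAR, Matrix.transpose_mul, Matrix.diagonal_transpose, Matrix.mul_assoc,
      ← Matrix.mul_assoc Wᵀ, hW, Matrix.one_mul, Matrix.diagonal_mul_diagonal]
    simp only [Real.mul_self_sqrt (hσ _)]
  calc K * Matrix.diagonal σ * Kᵀ = (K * Rᵀ) * (Aᵀ * A) * (R * Kᵀ) := by
        rw [← hgram]
        simp only [Matrix.transpose_mul, Matrix.mul_assoc]
    _ = Aᵀ * A := by rw [hKR, hRK, Matrix.one_mul, Matrix.mul_one]

theorem transpose_mul_inv_diagonal_mul_inv {n : Type*} [Fintype n] [DecidableEq n]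
    (σ : n → ℝ) {K R : Matrix n n ℝ} (hKR : K * Rᵀ = 1) :
    (R * (Matrix.diagonal σ)⁻¹ * K⁻¹)ᵀ = (K * Matrix.diagonal σ * Kᵀ)⁻¹ := by
  have hR : R = (K⁻¹)ᵀ := by rw [Matrix.inv_eq_right_inv hKR, Matrix.transpose_transpose]
  rw [hR, Matrix.mul_inv_rev, Matrix.mul_inv_rev]
  simp only [Matrix.transpose_mul, Matrix.transpose_transpose, Matrix.transpose_nonsing_inv,
    Matrix.diagonal_transpose, Matrix.mul_assoc]

/-- **Algebraic identities for the alignment matrices `K` and `R`.**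
With `X̃ Yᵀ = Ū Σ̄ V̄ᵀ`, `X̃ K = Ū Σ̄^{1/2}`, `Y R = V̄ Σ̄^{1/2}` and `K Rᵀ = I`,
one has `K Σ̄ Kᵀ = Yᵀ Y`, `R Σ̄ Rᵀ = X̃ᵀ X̃`, `(R Σ̄⁻¹ K⁻¹)ᵀ = (Yᵀ Y)⁻¹` and
`(K Σ̄⁻¹ R⁻¹)ᵀ = (X̃ᵀ X̃)⁻¹`. -/
theorem alignment_matrices_identities {n p d : ℕ}
    (Xt : Matrix (Fin n) (Fin d) ℝ) (Y : Matrix (Fin p) (Fin d) ℝ)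
    (hX : Xt.rank = d) (hY : Y.rank = d)
    (U : Matrix (Fin n) (Fin d) ℝ) (V : Matrix (Fin p) (Fin d) ℝ)
    (σ : Fin d → ℝ) (hσ : ∀ i, 0 < σ i)
    (hU : Uᵀ * U = 1) (hV : Vᵀ * V = 1)
    (hSVD : Xt * Yᵀ = U * Matrix.diagonal σ * Vᵀ)
    (K R : Matrix (Fin d) (Fin d) ℝ) (hK : IsUnit K) (hR : IsUnit R)
    (hXK : Xt * K = U * Matrix.diagonal (fun i => Real.sqrt (σ i)))
    (hYR : Y * R = V * Matrix.diagonal (fun i => Real.sqrt (σ i)))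
    (hKR : K * Rᵀ = 1) :
    K * Matrix.diagonal σ * Kᵀ = Yᵀ * Y ∧
    R * Matrix.diagonal σ * Rᵀ = Xtᵀ * Xt ∧
    (R * (Matrix.diagonal σ)⁻¹ * K⁻¹)ᵀ = (Yᵀ * Y)⁻¹ ∧
    (K * (Matrix.diagonal σ)⁻¹ * R⁻¹)ᵀ = (Xtᵀ * Xt)⁻¹ := by
  have hRK : R * Kᵀ = 1 := by simpa using congrArg Matrix.transpose hKR
  have hσ' : ∀ i, 0 ≤ σ i := fun i => (hσ i).le
  have hY' := mul_diagonal_mul_transpose_eq_gram hσ' hV hYR hKR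
  have hX' := mul_diagonal_mul_transpose_eq_gram hσ' hU hXK hRK
  refine ⟨hY', hX', ?_, ?_⟩
  · rw [← hY', transpose_mul_inv_diagonal_mul_inv σ hKR]
  · rw [← hX', transpose_mul_inv_diagonal_mul_inv σ hRK]
end

section
/- Let U, Û ∈ ℝ^{n×d} both have orthonormal columns (UᵀU = ÛᵀÛ = I_d). Then there exists an orthogonal matrix W ∈ ℝ^{d×d} such that ‖Uᵀ Û − W‖_F ≤ d·‖Û Ûᵀ − U Uᵀ‖_2², where ‖·‖_F is the Frobenius norm and ‖·‖_2 the spectral norm. -/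
open Matrix

/-- The Frobenius norm of a real matrix. -/
noncomputable def frobNorm {n m : ℕ} (M : Matrix (Fin n) (Fin m) ℝ) : ℝ :=
  Real.sqrt (∑ i : Fin n, ∑ j : Fin m, (M i j) ^ 2)

/-- The spectral (ℓ2→ℓ2 operator) norm of a real matrix. -/
noncomputable def specNorm {n m : ℕ} (M : Matrix (Fin n) (Fin m) ℝ) : ℝ :=
  ‖LinearMap.toContinuousLinearMap (Matrix.toEuclideanLin M)‖

theorem sum_sq_eq_trace_transpose_mul_self {n m : ℕ} (M : Matrix (Fin n) (Fin m) ℝ) :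
    ∑ i : Fin n, ∑ j : Fin m, (M i j) ^ 2 = (Mᵀ * M).trace := by
  rw [Finset.sum_comm]
  simp [Matrix.trace, Matrix.mul_apply, sq]

/-- Singular value decomposition of a square real matrix. -/
theorem exists_singular_value_decomposition {d : ℕ} (A : Matrix (Fin d) (Fin d) ℝ) :
    ∃ (P Q : Matrix (Fin d) (Fin d) ℝ) (σ : Fin d → ℝ), Pᵀ * P = 1 ∧ Qᵀ * Q = 1 ∧
      (∀ i, 0 ≤ σ i) ∧ A * Q = P * diagonal σ := by
  have hpos : (Aᵀ * A).PosSemidef := by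
    simpa [conjTranspose_eq_transpose_of_trivial] using posSemidef_conjTranspose_mul_self A
  have hA := hpos.isHermitian
  set Q : Matrix (Fin d) (Fin d) ℝ := hA.eigenvectorUnitary.val
  set ev := hA.eigenvalues
  have hQQ : Qᵀ * Q = 1 := by
    have := Unitary.coe_star_mul_self hA.eigenvectorUnitary
    simpa [star_eq_conjTranspose, conjTranspose_eq_transpose_of_trivial] using this
  have hD : (A * Q)ᵀ * (A * Q) = diagonal ev := by
    have h : Aᵀ * A = Q * diagonal ev * Qᵀ := by
      have := hA.spectral_theorem
      simpa [Unitary.conjStarAlgAut_apply, star_eq_conjTranspose,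
        conjTranspose_eq_transpose_of_trivial, Function.comp_def] using this
    calc (A * Q)ᵀ * (A * Q) = Qᵀ * (Aᵀ * A) * Q := by
          simp only [transpose_mul, Matrix.mul_assoc]
      _ = (Qᵀ * Q) * diagonal ev * (Qᵀ * Q) := by rw [h]; simp only [Matrix.mul_assoc]
      _ = diagonal ev := by simp [hQQ]
  set B := A * Q
  have hBB : ∀ i j, ∑ k, B k i * B k j = if i = j then ev i else 0 := by
    intro i j
    have := congrFun (congrFun hD i) j
    simpa [Matrix.mul_apply, diagonal_apply] using this
  have hev0 : ∀ i, 0 ≤ ev i := hpos.eigenvalues_nonneg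
  let w : Fin d → EuclideanSpace ℝ (Fin d) :=
    fun i => WithLp.toLp 2 fun k => (√(ev i))⁻¹ * B k i
  have hw : Orthonormal ℝ ({i | ev i ≠ 0}.domRestrict w) := by
    rw [orthonormal_iff_ite]
    rintro ⟨i, hi⟩ ⟨j, hj⟩
    have h1 : inner ℝ (w i) (w j) = (√(ev i))⁻¹ * (√(ev j))⁻¹ * ∑ k, B k i * B k j := by
      simp only [w, PiLp.inner_apply, Finset.mul_sum]
      refine Finset.sum_congr rfl fun k _ => ?_
      simp
      ring
    simp only [Set.domRestrict_apply, Subtype.mk.injEq]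
    rw [h1, hBB]
    split_ifs with h
    · subst h
      have h2 : √(ev i) ≠ 0 := (Real.sqrt_pos.2 (lt_of_le_of_ne (hev0 i) (Ne.symm hi))).ne'
      nth_rewrite 3 [← Real.mul_self_sqrt (hev0 i)]
      field_simp
    · simp
  obtain ⟨b, hb⟩ := hw.exists_orthonormalBasis_extension_of_card_eq (by simp)
  refine ⟨Matrix.of fun k i => b i k, Q, fun i => √(ev i), ?_, hQQ,
    fun i => Real.sqrt_nonneg _, ?_⟩
  · ext i j
    have := orthonormal_iff_ite.1 b.orthonormal i j
    simpa [Matrix.mul_apply, one_apply, PiLp.inner_apply, mul_comm] using this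
  · ext k i
    simp only [mul_diagonal, of_apply]
    by_cases hi : ev i = 0
    · have h := hBB i i
      simp only [if_true, hi] at h
      rw [Finset.sum_eq_zero_iff_of_nonneg fun k _ => mul_self_nonneg _] at h
      simpa [hi] using h k (Finset.mem_univ k)
    · have h2 : √(ev i) ≠ 0 := (Real.sqrt_pos.2 (lt_of_le_of_ne (hev0 i) (Ne.symm hi))).ne'
      rw [hb i hi]
      simp only [w]
      field_simp
      rfl

/-- A column of `D * N` is bounded by the spectral norm of `D` times the column of `N`. -/
theorem gram_mul_apply_self_le {n m d : ℕ} (D : Matrix (Fin n) (Fin m) ℝ)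
    (N : Matrix (Fin m) (Fin d) ℝ) (i : Fin d) :
    ((D * N)ᵀ * (D * N)) i i ≤ specNorm D ^ 2 * (Nᵀ * N) i i := by
  have hcol : ∀ {l : ℕ} (M : Matrix (Fin l) (Fin d) ℝ),
      (Mᵀ * M) i i = ‖(WithLp.toLp 2 (M.col i) : EuclideanSpace ℝ (Fin l))‖ ^ 2 := by
    intro l M
    rw [EuclideanSpace.norm_sq_eq]
    simp [Matrix.mul_apply, sq]
  have h := (LinearMap.toContinuousLinearMap (Matrix.toEuclideanLin D)).le_opNorm
    (WithLp.toLp 2 (N.col i))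
  have he : LinearMap.toContinuousLinearMap (Matrix.toEuclideanLin D) (WithLp.toLp 2 (N.col i))
      = WithLp.toLp 2 ((D * N).col i) := by
    ext k
    simp [Matrix.mul_apply, Matrix.mulVec, dotProduct, Matrix.toLpLin_apply]
  rw [he] at h
  rw [hcol, hcol, ← mul_pow]
  exact pow_le_pow_left₀ (norm_nonneg _) h 2

/-- **Approximation by an orthogonal matrix (Procrustes-type bound).**
If `U, Û ∈ ℝ^{n×d}` have orthonormal columns, then there exists an orthogonal
`W ∈ ℝ^{d×d}` with `‖Uᵀ Û − W‖_F ≤ d·‖Û Ûᵀ − U Uᵀ‖₂²`. -/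
theorem exists_orthogonal_procrustes_bound {n d : ℕ}
    (U Uh : Matrix (Fin n) (Fin d) ℝ)
    (hU : Uᵀ * U = 1) (hUh : Uhᵀ * Uh = 1) :
    ∃ W : Matrix (Fin d) (Fin d) ℝ, Wᵀ * W = 1 ∧ W * Wᵀ = 1 ∧
      frobNorm (Uᵀ * Uh - W) ≤ (d : ℝ) * specNorm (Uh * Uhᵀ - U * Uᵀ) ^ 2 := by
  obtain ⟨P, Q, σ, hP, hQ, hσ, hPQ⟩ := exists_singular_value_decomposition (Uᵀ * Uh)
  have hQ' : Q * Qᵀ = 1 := mul_eq_one_comm.1 hQ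
  have hW : (P * Qᵀ)ᵀ * (P * Qᵀ) = 1 := by
    calc (P * Qᵀ)ᵀ * (P * Qᵀ) = Q * (Pᵀ * P) * Qᵀ := by
          simp only [transpose_mul, transpose_transpose, Matrix.mul_assoc]
      _ = 1 := by rw [hP, Matrix.mul_one, hQ']
  refine ⟨P * Qᵀ, hW, mul_eq_one_comm.1 hW, ?_⟩
  set s := specNorm (Uh * Uhᵀ - U * Uᵀ) ^ 2 with hs
  have hs0 : 0 ≤ s := sq_nonneg _
  have hN : (Uh * Q)ᵀ * (Uh * Q) = 1 := by
    calc (Uh * Q)ᵀ * (Uh * Q) = Qᵀ * (Uhᵀ * Uh) * Q := by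
          simp only [transpose_mul, Matrix.mul_assoc]
      _ = 1 := by rw [hUh, Matrix.mul_one, hQ]
  have hM : (Uh * Uhᵀ - U * Uᵀ) * (Uh * Q) = Uh * Q - U * (P * diagonal σ) := by
    calc _ = Uh * (Uhᵀ * Uh) * Q - U * (Uᵀ * Uh * Q) := by
          simp only [Matrix.sub_mul, Matrix.mul_assoc]
      _ = _ := by rw [hUh, Matrix.mul_one, hPQ]
  have hPQt : Qᵀ * (Uhᵀ * U) = diagonal σ * Pᵀ := by
    simpa [transpose_mul, Matrix.mul_assoc] using congrArg transpose hPQ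
  have hG : (Uh * Q - U * (P * diagonal σ))ᵀ * (Uh * Q - U * (P * diagonal σ))
      = 1 - diagonal fun i => σ i * σ i := by
    have h1 : (U * (P * diagonal σ))ᵀ * (U * (P * diagonal σ)) = diagonal fun i => σ i * σ i := by
      calc _ = diagonal σ * (Pᵀ * ((Uᵀ * U) * P)) * diagonal σ := by
            simp only [transpose_mul, diagonal_transpose, Matrix.mul_assoc]
        _ = _ := by rw [hU, Matrix.one_mul, hP, Matrix.mul_one, diagonal_mul_diagonal]
    have h2 : (Uh * Q)ᵀ * (U * (P * diagonal σ)) = diagonal fun i => σ i * σ i := by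
      calc _ = (Qᵀ * (Uhᵀ * U)) * P * diagonal σ := by
            simp only [transpose_mul, Matrix.mul_assoc]
        _ = diagonal σ * (Pᵀ * P) * diagonal σ := by rw [hPQt]; simp only [Matrix.mul_assoc]
        _ = _ := by rw [hP, Matrix.mul_one, diagonal_mul_diagonal]
    have h3 : (U * (P * diagonal σ))ᵀ * (Uh * Q) = diagonal fun i => σ i * σ i := by
      simpa only [transpose_mul, transpose_transpose, diagonal_transpose] using
        congrArg transpose h2
    rw [transpose_sub, Matrix.sub_mul, Matrix.mul_sub, Matrix.mul_sub, hN, h1, h2, h3]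
    simp
  have hle : ∀ i, (σ i - 1) ^ 2 ≤ s ^ 2 := by
    intro i
    have h := gram_mul_apply_self_le (Uh * Uhᵀ - U * Uᵀ) (Uh * Q) i
    have hnn : 0 ≤ (((Uh * Uhᵀ - U * Uᵀ) * (Uh * Q))ᵀ *
        ((Uh * Uhᵀ - U * Uᵀ) * (Uh * Q))) i i := by
      rw [Matrix.mul_apply]
      exact Finset.sum_nonneg fun k _ => mul_self_nonneg _
    rw [hM, hG] at hnn h
    rw [hN, ← hs] at h
    simp only [Matrix.sub_apply, one_apply_eq, diagonal_apply_eq, mul_one] at h hnn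
    have h0 := hσ i
    have h1 : σ i ≤ 1 := by nlinarith
    have h2 : 1 - σ i ≤ s := by nlinarith
    nlinarith
  have hF : ((Uᵀ * Uh - P * Qᵀ)ᵀ * (Uᵀ * Uh - P * Qᵀ)).trace = ∑ i, (σ i - 1) ^ 2 := by
    have hX : Uᵀ * Uh - P * Qᵀ = P * diagonal (fun i => σ i - 1) * Qᵀ := by
      have h1 : Uᵀ * Uh = P * diagonal σ * Qᵀ := by
        rw [← hPQ, Matrix.mul_assoc _ Q, hQ', Matrix.mul_one]
      have h2 : diagonal (fun i => σ i - 1) = diagonal σ - 1 := by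
        rw [← diagonal_one, diagonal_sub]
      rw [h1, h2, Matrix.mul_sub, Matrix.sub_mul, Matrix.mul_one]
    calc _ = (Q * (diagonal (fun i => σ i - 1) * (Pᵀ * P) *
          diagonal (fun i => σ i - 1) * Qᵀ)).trace := by
          rw [hX]
          simp only [transpose_mul, transpose_transpose, diagonal_transpose, Matrix.mul_assoc]
      _ = _ := by
          rw [trace_mul_comm, Matrix.mul_assoc _ Qᵀ, hQ, hP, Matrix.mul_one, Matrix.mul_one,
            diagonal_mul_diagonal, trace_diagonal]
          simp only [sq]
  rw [frobNorm, sum_sq_eq_trace_transpose_mul_self, hF]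
  refine Real.sqrt_le_iff.2 ⟨by positivity, ?_⟩
  calc ∑ i, (σ i - 1) ^ 2 ≤ ∑ _i : Fin d, s ^ 2 := Finset.sum_le_sum fun i _ => hle i
    _ = (d : ℝ) * s ^ 2 := by simp
    _ ≤ (d : ℝ) ^ 2 * s ^ 2 := by
        gcongr
        exact_mod_cast Nat.le_self_pow two_ne_zero d
    _ = ((d : ℝ) * s) ^ 2 := by ring
end

section
/- Let Λ̂, Λ̄ ∈ ℝ^{n×p}. Let Û ∈ ℝ^{n×d}, V̂ ∈ ℝ^{p×d}, and let Σ̂ ∈ ℝ^{d×d} be diagonal with strictly positive diagonal entries, such that Λ̂ V̂ = Û Σ̂. Let Ū ∈ ℝ^{n×d}, V̄ ∈ ℝ^{p×d} have orthonormal columns and Σ̄ ∈ ℝ^{d×d} be diagonal with strictly positive diagonal entries, with Λ̄ = Ū Σ̄ V̄ᵀ. Let W ∈ ℝ^{d×d} be arbitrary. Define R₁ = Ū(Ūᵀ Û Σ̂^{1/2} − Σ̄^{1/2} W), R₂ = (I − Ū Ūᵀ)(Λ̂ − Λ̄)(V̂ − V̄ W) Σ̂^{−1/2}, R₃ = −Ū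 Ūᵀ (Λ̂ − Λ̄) V̄ W Σ̂^{−1/2}, and R₄ = (Λ̂ − Λ̄) V̄ (W Σ̂^{−1/2} − Σ̄^{−1/2} W). Then the exact identity Û Σ̂^{1/2} − Ū Σ̄^{1/2} W = (Λ̂ − Λ̄) V̄ Σ̄^{−1/2} W + R₁ + R₂ + R₃ + R₄ holds. -/
open Matrix

/-- **Exact residual decomposition for the left spectral embedding.**
With `Λ̂ V̂ = Û Σ̂`, `Λ̄ = Ū Σ̄ V̄ᵀ`, `Ū, V̄` having orthonormal columns and `Σ̂, Σ̄`
diagonal positive, for any `W` the identity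
`Û Σ̂^{1/2} − Ū Σ̄^{1/2} W = (Λ̂ − Λ̄) V̄ Σ̄^{−1/2} W + R₁ + R₂ + R₃ + R₄` holds, where
`R₁ = Ū(Ūᵀ Û Σ̂^{1/2} − Σ̄^{1/2} W)`,
`R₂ = (I − Ū Ūᵀ)(Λ̂ − Λ̄)(V̂ − V̄ W) Σ̂^{−1/2}`,
`R₃ = −Ū Ūᵀ (Λ̂ − Λ̄) V̄ W Σ̂^{−1/2}`,
`R₄ = (Λ̂ − Λ̄) V̄ (W Σ̂^{−1/2} − Σ̄^{−1/2} W)`. -/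
theorem embedding_residual_decomposition {n p d : ℕ}
    (Λh Λb : Matrix (Fin n) (Fin p) ℝ)
    (Uh : Matrix (Fin n) (Fin d) ℝ) (Vh : Matrix (Fin p) (Fin d) ℝ)
    (σh : Fin d → ℝ) (hσh : ∀ i, 0 < σh i)
    (hSVDh : Λh * Vh = Uh * Matrix.diagonal σh)
    (Ub : Matrix (Fin n) (Fin d) ℝ) (Vb : Matrix (Fin p) (Fin d) ℝ)
    (σb : Fin d → ℝ) (hσb : ∀ i, 0 < σb i)
    (hUb : Ubᵀ * Ub = 1) (hVb : Vbᵀ * Vb = 1)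
    (hΛb : Λb = Ub * Matrix.diagonal σb * Vbᵀ)
    (W : Matrix (Fin d) (Fin d) ℝ) :
    Uh * Matrix.diagonal (fun i => Real.sqrt (σh i))
      - Ub * Matrix.diagonal (fun i => Real.sqrt (σb i)) * W
    = (Λh - Λb) * Vb * Matrix.diagonal (fun i => (Real.sqrt (σb i))⁻¹) * W
      + Ub * (Ubᵀ * Uh * Matrix.diagonal (fun i => Real.sqrt (σh i))
          - Matrix.diagonal (fun i => Real.sqrt (σb i)) * W)
      + ((1 : Matrix (Fin n) (Fin n) ℝ) - Ub * Ubᵀ) * (Λh - Λb) * (Vh - Vb * W)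
          * Matrix.diagonal (fun i => (Real.sqrt (σh i))⁻¹)
      + (-(Ub * Ubᵀ * (Λh - Λb) * Vb * W
          * Matrix.diagonal (fun i => (Real.sqrt (σh i))⁻¹)))
      + (Λh - Λb) * Vb * (W * Matrix.diagonal (fun i => (Real.sqrt (σh i))⁻¹)
          - Matrix.diagonal (fun i => (Real.sqrt (σb i))⁻¹) * W) := by
  have hann : ((1 : Matrix (Fin n) (Fin n) ℝ) - Ub * Ubᵀ) * Λb = 0 := by
    have hproj : Ub * Ubᵀ * Λb = Λb := by
      rw [hΛb, Matrix.mul_assoc Ub Ubᵀ, ← Matrix.mul_assoc Ubᵀ, ← Matrix.mul_assoc Ubᵀ, hUb,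
        Matrix.one_mul, Matrix.mul_assoc]
    rw [Matrix.sub_mul, Matrix.one_mul, hproj, sub_self]
  have hdiag : Matrix.diagonal σh * Matrix.diagonal (fun i => (Real.sqrt (σh i))⁻¹)
      = Matrix.diagonal (fun i => Real.sqrt (σh i)) := by
    rw [Matrix.diagonal_mul_diagonal]
    congr 1
    funext i
    rw [← div_eq_mul_inv, Real.div_sqrt]
  have hres : ((1 : Matrix (Fin n) (Fin n) ℝ) - Ub * Ubᵀ) * (Λh - Λb) * Vh
        * Matrix.diagonal (fun i => (Real.sqrt (σh i))⁻¹)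
      = (1 - Ub * Ubᵀ) * Uh * Matrix.diagonal (fun i => Real.sqrt (σh i)) := by
    rw [Matrix.mul_sub _ Λh, hann, sub_zero, Matrix.mul_assoc _ Λh, hSVDh, Matrix.mul_assoc,
      Matrix.mul_assoc Uh, hdiag, Matrix.mul_assoc]
  rw [Matrix.mul_sub _ Vh, Matrix.sub_mul _ _ (Matrix.diagonal _), hres]
  generalize Λh - Λb = E
  simp only [Matrix.mul_sub, Matrix.sub_mul, Matrix.one_mul, Matrix.mul_assoc]
  abel
end

section
/- Let Q ∈ ℝ^{d×d} be symmetric positive definite, let (n_k)_{k∈ℕ} be positive integers with n_k → ∞, and for each k let X_k ∈ ℝ^{n_k × d} have rank d, with (1/n_k)·X_kᵀ X_k converging entrywise to Q and sup_k ‖X_k‖_{2,∞} ≤ B for some B < ∞. For each k let X_k = U_k Σ_k V_kᵀ be a skinny singular value decomposition, where U_k ∈ ℝ^{n_k×d} has orthonormal columns and Σ_k is diagonal with positive entries. Then there exist a constant C and an index k₀ such that ‖U_k‖_{2,∞} ≤ C·n_k^{−1/2} for all k ≥ k₀; in particular the incoherence parameters (n_k/d)·‖U_k‖_{2,∞}²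 are bounded uniformly in k. -/
open Matrix Filter

/-- The two-to-infinity norm of a real matrix: the maximum Euclidean norm of its rows. -/
noncomputable def norm2inf {n d : ℕ} (M : Matrix (Fin n) (Fin d) ℝ) : ℝ :=
  ⨆ i : Fin n, Real.sqrt (∑ j : Fin d, (M i j) ^ 2)

theorem norm2inf_nonneg {n d : ℕ} (M : Matrix (Fin n) (Fin d) ℝ) : 0 ≤ norm2inf M :=
  Real.iSup_nonneg fun _ => Real.sqrt_nonneg _

theorem sum_row_sq_le_norm2inf_sq {n d : ℕ} (M : Matrix (Fin n) (Fin d) ℝ) (i : Fin n) :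
    ∑ j, M i j ^ 2 ≤ norm2inf M ^ 2 :=
  (Real.sqrt_le_left (norm2inf_nonneg M)).1 <|
    le_ciSup (f := fun i => Real.sqrt (∑ j, M i j ^ 2)) (Set.finite_range _).bddAbove i

theorem norm2inf_le_sqrt {n d : ℕ} {M : Matrix (Fin n) (Fin d) ℝ} {a : ℝ}
    (h : ∀ i, ∑ j, M i j ^ 2 ≤ a) : norm2inf M ≤ Real.sqrt a :=
  Real.iSup_le (fun i => Real.sqrt_le_sqrt (h i)) (Real.sqrt_nonneg a)

theorem sum_row_mul_orthogonal_sq {m d : ℕ} (X : Matrix (Fin m) (Fin d) ℝ)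
    {V : Matrix (Fin d) (Fin d) ℝ} (hV : V * Vᵀ = 1) (i : Fin m) :
    ∑ j, (X * V) i j ^ 2 = ∑ j, X i j ^ 2 := by
  have h : (X * V) * (X * V)ᵀ = X * Xᵀ := by
    rw [transpose_mul, Matrix.mul_assoc, ← Matrix.mul_assoc V, hV, Matrix.one_mul]
  simp only [sq]
  exact congrFun (congrFun h i) i

theorem norm2inf_left_singular_le {m d : ℕ} {X U : Matrix (Fin m) (Fin d) ℝ}
    {V : Matrix (Fin d) (Fin d) ℝ} {σ : Fin d → ℝ} (hσ : ∀ i, 0 < σ i) (hV : Vᵀ * V = 1)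
    (hSVD : X = U * diagonal σ * Vᵀ) :
    norm2inf U ≤ Real.sqrt (norm2inf X ^ 2 * ∑ i, (σ i ^ 2)⁻¹) := by
  refine norm2inf_le_sqrt fun i => ?_
  rw [Finset.mul_sum]
  refine Finset.sum_le_sum fun j _ => ?_
  have hXV : X * V = U * diagonal σ := by
    rw [hSVD, Matrix.mul_assoc, hV, Matrix.mul_one]
  have hrow : (U i j * σ j) ^ 2 ≤ norm2inf X ^ 2 := by
    rw [← mul_diagonal, ← hXV]
    calc (X * V) i j ^ 2 ≤ ∑ j, (X * V) i j ^ 2 :=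
          Finset.single_le_sum (f := fun j => (X * V) i j ^ 2) (fun _ _ => sq_nonneg _)
            (Finset.mem_univ j)
      _ = ∑ j, X i j ^ 2 := sum_row_mul_orthogonal_sq X (mul_eq_one_comm.1 hV) i
      _ ≤ norm2inf X ^ 2 := sum_row_sq_le_norm2inf_sq X i
  rw [← div_eq_mul_inv, le_div_iff₀ (pow_pos (hσ j) 2), ← mul_pow]
  exact hrow

theorem trace_inv_gram_div {m d : ℕ} {X U : Matrix (Fin m) (Fin d) ℝ}
    {V : Matrix (Fin d) (Fin d) ℝ} {σ : Fin d → ℝ} (hσ : ∀ i, 0 < σ i) (hU : Uᵀ * U = 1)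
    (hV : Vᵀ * V = 1) (hSVD : X = U * diagonal σ * Vᵀ) {a : ℝ} (ha : a ≠ 0) :
    (a⁻¹ • (Xᵀ * X))⁻¹.trace = a * ∑ i, (σ i ^ 2)⁻¹ := by
  have hgram : Xᵀ * X = V * (diagonal fun i => σ i ^ 2) * Vᵀ := by
    calc Xᵀ * X = V * (diagonal σ * (Uᵀ * U) * diagonal σ) * Vᵀ := by
          simp only [hSVD, transpose_mul, transpose_transpose, diagonal_transpose,
            Matrix.mul_assoc]
      _ = V * (diagonal fun i => σ i ^ 2) * Vᵀ := by
          simp only [hU, Matrix.mul_one, diagonal_mul_diagonal, sq]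
  have hdiag : (diagonal fun i => σ i ^ 2) * (diagonal fun i => (σ i ^ 2)⁻¹) = 1 := by
    rw [diagonal_mul_diagonal, ← diagonal_one]
    exact congrArg diagonal (funext fun i => mul_inv_cancel₀ (pow_pos (hσ i) 2).ne')
  have hinv : (a⁻¹ • (Xᵀ * X))⁻¹ = a • (V * (diagonal fun i => (σ i ^ 2)⁻¹) * Vᵀ) := by
    refine inv_eq_right_inv ?_
    rw [smul_mul_smul_comm, inv_mul_cancel₀ ha, one_smul, hgram]
    calc _ = V * ((diagonal fun i => σ i ^ 2) * (Vᵀ * V) * diagonal fun i => (σ i ^ 2)⁻¹) * Vᵀ := by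
          simp only [Matrix.mul_assoc]
      _ = 1 := by rw [hV, Matrix.mul_one, hdiag, Matrix.mul_one, mul_eq_one_comm.1 hV]
  rw [hinv, trace_smul, trace_mul_comm, ← Matrix.mul_assoc, hV, Matrix.one_mul, trace_diagonal,
    smul_eq_mul]

/-- **Bounded incoherence under second-moment stability and bounded rows.**
If `Q` is symmetric positive definite, `n_k → ∞`, `X_k ∈ ℝ^{n_k×d}` has rank `d`,
`(1/n_k)X_kᵀX_k → Q` entrywise and `‖X_k‖_{2,∞} ≤ B` uniformly, then for skinny SVDs
`X_k = U_k Σ_k V_kᵀ` one eventually has `‖U_k‖_{2,∞} ≤ C·n_k^{−1/2}`; in particular the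
incoherence parameters `(n_k/d)·‖U_k‖_{2,∞}²` are bounded uniformly in `k`. -/
theorem incoherence_bounded {d : ℕ}
    (Q : Matrix (Fin d) (Fin d) ℝ) (hQsymm : Qᵀ = Q) (hQpd : Q.PosDef)
    (n : ℕ → ℕ) (hn_pos : ∀ k, 0 < n k)
    (hn_tendsto : Tendsto (fun k => (n k : ℝ)) atTop atTop)
    (X : (k : ℕ) → Matrix (Fin (n k)) (Fin d) ℝ)
    (hrank : ∀ k, (X k).rank = d)
    (hconv : ∀ i j : Fin d,
      Tendsto (fun k => ((X k)ᵀ * X k) i j / (n k : ℝ)) atTop (nhds (Q i j)))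
    (B : ℝ) (hB : ∀ k, norm2inf (X k) ≤ B)
    (U : (k : ℕ) → Matrix (Fin (n k)) (Fin d) ℝ)
    (V : ℕ → Matrix (Fin d) (Fin d) ℝ)
    (σ : ℕ → Fin d → ℝ) (hσ_pos : ∀ k i, 0 < σ k i)
    (hU : ∀ k, (U k)ᵀ * U k = 1) (hV : ∀ k, (V k)ᵀ * V k = 1)
    (hSVD : ∀ k, X k = U k * Matrix.diagonal (σ k) * (V k)ᵀ) :
    (∃ C : ℝ, ∃ k₀ : ℕ, ∀ k ≥ k₀, norm2inf (U k) ≤ C / Real.sqrt (n k)) ∧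
    (∃ C' : ℝ, ∀ k, ((n k : ℝ) / d) * norm2inf (U k) ^ 2 ≤ C') := by
  have hn0 : ∀ k, (0 : ℝ) < n k := fun k => Nat.cast_pos.2 (hn_pos k)
  have hM : Tendsto (fun k => (n k : ℝ)⁻¹ • ((X k)ᵀ * X k)) atTop (nhds Q) := by
    refine tendsto_pi_nhds.2 fun i => tendsto_pi_nhds.2 fun j => ?_
    simpa [div_eq_inv_mul] using hconv i j
  have hinv : ContinuousAt Ring.inverse Q.det := by
    simpa only [Ring.inverse_eq_inv'] using continuousAt_inv₀ hQpd.det_pos.ne'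
  have htrace := (continuous_id.matrix_trace.tendsto Q⁻¹).comp
    ((continuousAt_matrix_inv Q hinv).tendsto.comp hM)
  obtain ⟨K, hK⟩ := htrace.bddAbove_range
  have hK' : ∀ k, n k * ∑ i, (σ k i ^ 2)⁻¹ ≤ K := fun k => by
    rw [← trace_inv_gram_div (hσ_pos k) (hU k) (hV k) (hSVD k) (hn0 k).ne']
    exact hK ⟨k, rfl⟩
  have hmain : ∀ k, norm2inf (U k) ≤ Real.sqrt (B ^ 2 * K) / Real.sqrt (n k) := fun k => by
    rw [← Real.sqrt_div' _ (hn0 k).le]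
    refine (norm2inf_left_singular_le (hσ_pos k) (hV k) (hSVD k)).trans (Real.sqrt_le_sqrt ?_)
    rw [mul_div_assoc]
    refine mul_le_mul (pow_le_pow_left₀ (norm2inf_nonneg _) (hB k) 2) ?_
      (Finset.sum_nonneg fun i _ => by positivity) (sq_nonneg B)
    rw [le_div_iff₀' (hn0 k)]
    exact hK' k
  refine ⟨⟨_, 0, fun k _ => hmain k⟩, Real.sqrt (B ^ 2 * K) ^ 2 / d, fun k => ?_⟩
  have hsq := pow_le_pow_left₀ (norm2inf_nonneg (U k)) (hmain k) 2
  rw [div_pow, Real.sq_sqrt (hn0 k).le, le_div_iff₀' (hn0 k)] at hsq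
  rw [div_mul_eq_mul_div]
  exact div_le_div_of_nonneg_right hsq (Nat.cast_nonneg d)
end
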